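/- Let L be a lattice with more than one element. The lattice M̂(L) of Boolean triples of L is modular if and only if L is distributive. (Modularity of M̂(L): for all Boolean triples a, b, c with a ≤ c componentwise, the join of a with (componentwise meet of b and c), formed in M̂(L), equals the componentwise meet of (the join of a and b in M̂(L)) with c.) -/

import Mathlib

/-- A triple `(x, y, z)` in a lattice is *Boolean* if
`x = (x ⊔ y) ⊓ (x ⊔ z)`, `y = (y ⊔ x) ⊓ (y ⊔ z)`, `z = (z ⊔ x) ⊓ (z ⊔ y)`. -/
def IsBoolean {L : Type*} [Lattice L] (t : L × L × L) : Prop :=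
  t.1 = (t.1 ⊔ t.2.1) ⊓ (t.1 ⊔ t.2.2) ∧
  t.2.1 = (t.2.1 ⊔ t.1) ⊓ (t.2.1 ⊔ t.2.2) ∧
  t.2.2 = (t.2.2 ⊔ t.1) ⊓ (t.2.2 ⊔ t.2.1)

/-- The Boolean closure of a triple. -/
def bClosure {L : Type*} [Lattice L] (t : L × L × L) : L × L × L :=
  ((t.1 ⊔ t.2.1) ⊓ (t.1 ⊔ t.2.2),
   (t.2.1 ⊔ t.1) ⊓ (t.2.1 ⊔ t.2.2),
   (t.2.2 ⊔ t.1) ⊓ (t.2.2 ⊔ t.2.1))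

variable {L : Type*} [Lattice L]

theorem isBoolean_of_rep (u v w : L) :
    IsBoolean ((u ⊓ v, u ⊓ w, v ⊓ w) : L × L × L) := by
  refine ⟨le_antisymm (le_inf le_sup_left le_sup_left) ?_,
          le_antisymm (le_inf le_sup_left le_sup_left) ?_,
          le_antisymm (le_inf le_sup_left le_sup_left) ?_⟩
  · exact inf_le_inf (sup_le inf_le_left inf_le_left) (sup_le inf_le_right inf_le_left)
  · exact inf_le_inf (sup_le inf_le_left inf_le_left) (sup_le inf_le_right inf_le_right)
  · exact inf_le_inf (sup_le inf_le_left inf_le_right) (sup_le inf_le_right inf_le_right)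

theorem isBoolean_iff_rep (t : L × L × L) :
    IsBoolean t ↔ ∃ u v w : L, t.1 = u ⊓ v ∧ t.2.1 = u ⊓ w ∧ t.2.2 = v ⊓ w := by
  constructor
  · rintro ⟨h1, h2, h3⟩
    refine ⟨t.1 ⊔ t.2.1, t.1 ⊔ t.2.2, t.2.1 ⊔ t.2.2, h1, ?_, ?_⟩
    · conv_lhs => rw [h2]
      rw [sup_comm t.2.1 t.1]
    · conv_lhs => rw [h3]
      rw [sup_comm t.2.2 t.1, sup_comm t.2.2 t.2.1]
  · rintro ⟨u, v, w, h1, h2, h3⟩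
    obtain ⟨a, b, c⟩ := t
    simp only at h1 h2 h3
    subst h1 h2 h3
    exact isBoolean_of_rep u v w

theorem bClosure_isBoolean (t : L × L × L) : IsBoolean (bClosure t) := by
  rw [isBoolean_iff_rep]
  refine ⟨t.1 ⊔ t.2.1, t.1 ⊔ t.2.2, t.2.1 ⊔ t.2.2, rfl, ?_, ?_⟩
  · show (t.2.1 ⊔ t.1) ⊓ (t.2.1 ⊔ t.2.2) = _
    rw [sup_comm t.2.1 t.1]
  · show (t.2.2 ⊔ t.1) ⊓ (t.2.2 ⊔ t.2.1) = _
    rw [sup_comm t.2.2 t.1, sup_comm t.2.2 t.2.1]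

theorem IsBoolean.inf {a b : L × L × L} (ha : IsBoolean a) (hb : IsBoolean b) :
    IsBoolean (a ⊓ b) := by
  rw [isBoolean_iff_rep] at ha hb ⊢
  obtain ⟨u, v, w, h1, h2, h3⟩ := ha
  obtain ⟨u', v', w', h1', h2', h3'⟩ := hb
  refine ⟨u ⊓ u', v ⊓ v', w ⊓ w', ?_, ?_, ?_⟩
  · show a.1 ⊓ b.1 = _
    rw [h1, h1', inf_inf_inf_comm]
  · show a.2.1 ⊓ b.2.1 = _
    rw [h2, h2', inf_inf_inf_comm]
  · show a.2.2 ⊓ b.2.2 = _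
    rw [h3, h3', inf_inf_inf_comm]

theorem le_bClosure (t : L × L × L) : t ≤ bClosure t :=
  ⟨le_inf le_sup_left le_sup_left, le_inf le_sup_left le_sup_left,
   le_inf le_sup_left le_sup_left⟩

theorem bClosure_le {t c : L × L × L} (hc : IsBoolean c) (h : t ≤ c) :
    bClosure t ≤ c := by
  obtain ⟨h1, h2, h3⟩ := h
  refine ⟨?_, ?_, ?_⟩
  · rw [hc.1]; exact inf_le_inf (sup_le_sup h1 h2) (sup_le_sup h1 h3)
  · rw [hc.2.1]; exact inf_le_inf (sup_le_sup h2 h1) (sup_le_sup h2 h3)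
  · rw [hc.2.2]; exact inf_le_inf (sup_le_sup h3 h1) (sup_le_sup h3 h2)

/-- The lattice `M̂(L)` of Boolean triples of `L`, ordered componentwise. -/
def BoolTriple (L : Type*) [Lattice L] := {t : L × L × L // IsBoolean t}

instance : PartialOrder (BoolTriple L) := Subtype.partialOrder _

instance : Lattice (BoolTriple L) where
  sup a b := ⟨bClosure (a.1 ⊔ b.1), bClosure_isBoolean _⟩
  le_sup_left a b := show a.1 ≤ bClosure (a.1 ⊔ b.1) from le_trans le_sup_left (le_bClosure _)
  le_sup_right a b := show b.1 ≤ bClosure (a.1 ⊔ b.1) from le_trans le_sup_right (le_bClosure _)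
  sup_le a b c hac hbc := show bClosure (a.1 ⊔ b.1) ≤ c.1 from bClosure_le c.2 (sup_le hac hbc)
  inf a b := ⟨a.1 ⊓ b.1, a.2.inf b.2⟩
  inf_le_left a b := show a.1 ⊓ b.1 ≤ a.1 from inf_le_left
  inf_le_right a b := show a.1 ⊓ b.1 ≤ b.1 from inf_le_right
  le_inf a b c hab hac := show a.1 ≤ b.1 ⊓ c.1 from le_inf hab hac

theorem IsBoolean.pair {t : L × L × L} (h : IsBoolean t) :
    t.2.1 ⊓ t.2.2 ≤ t.1 ∧ t.1 ⊓ t.2.2 ≤ t.2.1 ∧ t.1 ⊓ t.2.1 ≤ t.2.2 := by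
  obtain ⟨h1, h2, h3⟩ := h
  refine ⟨?_, ?_, ?_⟩
  · rw [h1]; exact inf_le_inf le_sup_right le_sup_right
  · rw [h2]; exact inf_le_inf le_sup_right le_sup_right
  · rw [h3]; exact inf_le_inf le_sup_right le_sup_right

theorem distrib_half {D : Type*} [DistribLattice D] {a1 a2 a3 b1 b2 b3 c1 c2 c3 : D}
    (h3 : a3 ≤ c3) (hb : b2 ⊓ b3 ≤ b1) (hc : c1 ⊓ c3 ≤ c2) :
    (((a1 ⊔ b1) ⊔ (a2 ⊔ b2)) ⊓ ((a1 ⊔ b1) ⊔ (a3 ⊔ b3))) ⊓ c1 ≤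
      (a1 ⊔ b1 ⊓ c1) ⊔ (a2 ⊔ b2 ⊓ c2) := by
  rw [← sup_inf_left, inf_sup_right, inf_sup_right]
  refine sup_le (sup_le ?_ ?_) ?_
  · exact inf_le_left.trans (le_sup_left.trans le_sup_left)
  · exact le_sup_right.trans le_sup_left
  · rw [inf_sup_right, inf_sup_right]
    refine sup_le ?_ ?_
    · exact (inf_le_left.trans inf_le_left).trans (le_sup_left.trans le_sup_right)
    · rw [inf_sup_left, inf_sup_right]
      refine sup_le ?_ ?_
      · refine le_trans (le_inf (inf_le_left.trans inf_le_left) (le_trans ?_ hc))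
          (le_sup_right.trans le_sup_right)
        exact le_inf inf_le_right ((inf_le_left.trans inf_le_right).trans h3)
      · exact (inf_le_inf_right _ hb).trans (le_sup_right.trans le_sup_left)

theorem distrib_full {D : Type*} [DistribLattice D] {a1 a2 a3 b1 b2 b3 c1 c2 c3 : D}
    (h2 : a2 ≤ c2) (h3 : a3 ≤ c3) (hb : b2 ⊓ b3 ≤ b1) (hc : c1 ⊓ c3 ≤ c2)
    (hc' : c1 ⊓ c2 ≤ c3) :
    (((a1 ⊔ b1) ⊔ (a2 ⊔ b2)) ⊓ ((a1 ⊔ b1) ⊔ (a3 ⊔ b3))) ⊓ c1 ≤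
      ((a1 ⊔ b1 ⊓ c1) ⊔ (a2 ⊔ b2 ⊓ c2)) ⊓ ((a1 ⊔ b1 ⊓ c1) ⊔ (a3 ⊔ b3 ⊓ c3)) := by
  refine le_inf (distrib_half h3 hb hc) ?_
  rw [inf_comm ((a1 ⊔ b1) ⊔ (a2 ⊔ b2))]
  exact distrib_half h2 (by rwa [inf_comm]) hc'

theorem isBoolean_single {o x : L} (h : o ≤ x) : IsBoolean ((x, o, o) : L × L × L) := by
  refine ⟨?_, ?_, ?_⟩ <;> simp [h]

/-- For a lattice `L` with more than one element, the lattice `M̂(L)` of Boolean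
triples is modular iff `L` is distributive. -/
theorem boolTriple_modular_iff_distrib (L : Type*) [Lattice L] [Nontrivial L] :
    (∀ a b c : BoolTriple L, a ≤ c → a ⊔ (b ⊓ c) = (a ⊔ b) ⊓ c) ↔
      (∀ x y z : L, x ⊓ (y ⊔ z) = (x ⊓ y) ⊔ (x ⊓ z)) := by
  constructor
  · intro H
    have key : ∀ x y z : L, (x ⊔ y) ⊓ (x ⊔ z) ≤ x ⊔ (y ⊓ z) := by
      intro x y z
      let o := x ⊓ (y ⊓ z)
      let i := x ⊔ (y ⊔ z)
      have hox : o ≤ x := inf_le_left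
      have hoyz : o ≤ y ⊓ z := inf_le_right
      have hoi : o ≤ i := hox.trans le_sup_left
      let a : BoolTriple L := ⟨(x, o, o), isBoolean_single hox⟩
      let b : BoolTriple L := ⟨(y ⊓ z, y, z), by
        refine ⟨?_, ?_, ?_⟩ <;> simp⟩
      let c : BoolTriple L := ⟨(i, o, o), isBoolean_single hoi⟩
      have hac : a ≤ c := show (x, o, o) ≤ (i, o, o) from
        ⟨(le_sup_left : x ≤ x ⊔ (y ⊔ z)), le_rfl, le_rfl⟩
      have h := congrArg (fun t : BoolTriple L => t.1.1) (H a b c hac)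
      have h' : ((x ⊔ (y ⊓ z) ⊓ i) ⊔ (o ⊔ y ⊓ o)) ⊓ ((x ⊔ (y ⊓ z) ⊓ i) ⊔ (o ⊔ z ⊓ o)) =
          (((x ⊔ y ⊓ z) ⊔ (o ⊔ y)) ⊓ ((x ⊔ y ⊓ z) ⊔ (o ⊔ z))) ⊓ i := h
      have h1 : (x ⊔ y) ⊓ (x ⊔ z) ≤
          (((x ⊔ y ⊓ z) ⊔ (o ⊔ y)) ⊓ ((x ⊔ y ⊓ z) ⊔ (o ⊔ z))) ⊓ i := by
        refine le_inf (inf_le_inf ?_ ?_) ?_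
        · exact sup_le_sup le_sup_left le_sup_right
        · exact sup_le_sup le_sup_left le_sup_right
        · exact inf_le_left.trans (sup_le_sup_left le_sup_left x)
      refine h1.trans (h'.symm.le.trans (inf_le_left.trans ?_))
      refine sup_le (sup_le_sup_left inf_le_left x) (sup_le ?_ ?_)
      · exact hox.trans le_sup_left
      · exact inf_le_right.trans (hox.trans le_sup_left)
    letI : DistribLattice L := { ‹Lattice L› with le_sup_inf := key }
    exact fun x y z => inf_sup_left x y z
  · intro H a b c hac
    letI : DistribLattice L := DistribLattice.ofInfSupLe (fun x y z => (H x y z).le)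
    refine le_antisymm (sup_le (le_inf le_sup_left hac)
      (inf_le_inf_right c le_sup_right)) ?_
    obtain ⟨b1, b2, b3⟩ := b.2.pair
    obtain ⟨c1, c2, c3⟩ := c.2.pair
    obtain ⟨h1, h2, h3⟩ := (show a.1 ≤ c.1 from hac)
    refine (show bClosure (a.1 ⊔ b.1) ⊓ c.1 ≤ bClosure (a.1 ⊔ (b.1 ⊓ c.1)) from ⟨?_, ?_, ?_⟩)
    · exact distrib_full h2 h3 b1 c2 c3
    · exact distrib_full h1 h3 b2 c1 (by rwa [inf_comm])
    · exact distrib_full h1 h2 b3 (by rwa [inf_comm]) (by rwa [inf_comm])
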